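/- arXiv:1312.1608 — 6 statements merged into one kernel-verified Lean document; each statement's English description precedes it below -/
import Mathlib

section
/- (Key Lemma) Let π : 𝒳 ⥤ ℬ and π' : 𝒴 ⥤ ℬ be functors, and let F : 𝒳 ⥤ 𝒴 and G : 𝒴 ⥤ 𝒳 be vertically adjoint functors over ℬ (F ⊣ G with vertical unit and counit). If x : X ⟶ Y is a cocartesian arrow of 𝒳 lying over a : A ⟶ B (with respect to π), then F x : F X ⟶ F Y is a cocartesian arrow of 𝒴 lying over a (with respect to π'). -/
open CategoryTheory Functor

/-- A functor over `ℬ` sends lifts of `f` to lifts of `f`. -/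
lemma CategoryTheory.IsHomLift.map_of_comp_eq {𝒳 𝒴 ℬ : Type*}
    [Category 𝒳] [Category 𝒴] [Category ℬ] {p : 𝒳 ⥤ ℬ} {q : 𝒴 ⥤ ℬ} {F : 𝒳 ⥤ 𝒴}
    (hF : F ⋙ q = p) {R S : ℬ} (f : R ⟶ S) {X Y : 𝒳} (φ : X ⟶ Y) [p.IsHomLift f φ] :
    q.IsHomLift f (F.map φ) := by
  subst hF
  subst_hom_lift (F ⋙ q) f φ
  exact IsHomLift.map q (F.map φ)

/-- For an adjunction over `ℬ` with vertical unit and counit, an arrow lifts `f` if and only if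
its transpose does. -/
lemma CategoryTheory.Adjunction.isHomLift_homEquiv_iff {𝒳 𝒴 ℬ : Type*}
    [Category 𝒳] [Category 𝒴] [Category ℬ] {p : 𝒳 ⥤ ℬ} {q : 𝒴 ⥤ ℬ} {F : 𝒳 ⥤ 𝒴} {G : 𝒴 ⥤ 𝒳}
    (hF : F ⋙ q = p) (hG : G ⋙ p = q) (adj : F ⊣ G)
    (hunit : ∀ X : 𝒳, p.IsHomLift (𝟙 (p.obj X)) (adj.unit.app X))
    (hcounit : ∀ Y : 𝒴, q.IsHomLift (𝟙 (q.obj Y)) (adj.counit.app Y))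
    {R S : ℬ} (f : R ⟶ S) {X : 𝒳} {Y : 𝒴} (ψ : F.obj X ⟶ Y) :
    p.IsHomLift f (adj.homEquiv X Y ψ) ↔ q.IsHomLift f ψ := by
  constructor <;> intro h
  · have := hcounit Y
    have := IsHomLift.map_of_comp_eq hF f (adj.homEquiv X Y ψ)
    rw [← (adj.homEquiv X Y).symm_apply_apply ψ, adj.homEquiv_counit]
    exact IsHomLift.comp_lift_id_right' q f _ (q.obj Y) _
  · have := hunit X
    have := IsHomLift.map_of_comp_eq hG f ψ
    rw [adj.homEquiv_unit]
    exact IsHomLift.comp_lift_id_left' p (p.obj X) _ f _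

/-- (Key Lemma) A vertically left adjoint functor over `ℬ` preserves cocartesian arrows. -/
theorem vertical_left_adjoint_preserves_cocartesian {𝒳 𝒴 ℬ : Type*}
    [Category 𝒳] [Category 𝒴] [Category ℬ]
    (π : 𝒳 ⥤ ℬ) (π' : 𝒴 ⥤ ℬ) (F : 𝒳 ⥤ 𝒴) (G : 𝒴 ⥤ 𝒳)
    (hF : F ⋙ π' = π) (hG : G ⋙ π = π') (adj : F ⊣ G)
    (hunit : ∀ X : 𝒳, π.IsHomLift (𝟙 (π.obj X)) (adj.unit.app X))
    (hcounit : ∀ Y : 𝒴, π'.IsHomLift (𝟙 (π'.obj Y)) (adj.counit.app Y))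
    {A B : ℬ} (a : A ⟶ B) {X Y : 𝒳} (x : X ⟶ Y) (hx : π.IsStronglyCocartesian a x) :
    π'.IsStronglyCocartesian a (F.map x) := by
  have lift_iff {R S : ℬ} (f : R ⟶ S) {X : 𝒳} {Z : 𝒴} (ψ : F.obj X ⟶ Z) :=
    adj.isHomLift_homEquiv_iff hF hG hunit hcounit f ψ
  have : π'.IsHomLift a (F.map x) := IsHomLift.map_of_comp_eq hF a x
  refine ⟨fun {Z} b z hz => ?_⟩
  have := (lift_iff (a ≫ b) z).2 hz
  obtain ⟨y, ⟨hy, hxy⟩, huniq⟩ := IsStronglyCocartesian.universal_property π a x b (a ≫ b) rfl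
    (adj.homEquiv X Z z)
  refine ⟨(adj.homEquiv Y Z).symm y, ⟨?_, ?_⟩, fun w ⟨hw, hxw⟩ => ?_⟩
  · rwa [← lift_iff, Equiv.apply_symm_apply]
  · rw [← adj.homEquiv_naturality_left_symm, hxy, Equiv.symm_apply_apply]
  · rw [Equiv.eq_symm_apply]
    exact huniq _ ⟨(lift_iff b w).2 hw, by rw [← adj.homEquiv_naturality_left, hxw]⟩
end

section
/- Let π : 𝒳 ⥤ ℬ be a functor and let T(𝒳) = Comma π (𝟭 ℬ) with codomain functor d₁ : T(𝒳) ⥤ ℬ. The assignment sending an object (X, a : π X ⟶ B) and an arrow b : B ⟶ C to the morphism (𝟙 X, b) : (X, a) ⟶ (X, a ≫ b) is a splitting of the opfibration d₁: each morphism (𝟙 X, b) is cocartesian over b with respect to d₁; the chosen lift of 𝟙 B at (X, a) is the identity of (X, a); and the chosen lifts compose, i.e. (𝟙 X, b) : (X,a) ⟶ (X, a ≫ b) followed by (𝟙 X, c) : (X, a ≫ b) ⟶ (X, (a ≫ b) ≫ c) equals (𝟙 X, b ≫ c) : (X,a) ⟶ (X, a ≫ (b ≫ c)). -/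
open CategoryTheory Functor

/-- The canonical cocartesian lifts `(𝟙 X, b) : (X, a) ⟶ (X, a ≫ b)` form a splitting of the
opfibration `Comma.snd π (𝟭 ℬ) : Comma π (𝟭 ℬ) ⥤ ℬ`: each such lift is cocartesian over `b`,
the lift of an identity is an identity, and the lifts compose. -/
theorem comma_canonical_splitting {𝒳 ℬ : Type*} [Category 𝒳] [Category ℬ] (π : 𝒳 ⥤ ℬ) :
    (∀ (X : 𝒳) {B C : ℬ} (a : π.obj X ⟶ B) (b : B ⟶ C),
      (Comma.snd π (𝟭 ℬ)).IsStronglyCocartesian b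
        (show (⟨X, B, a⟩ : Comma π (𝟭 ℬ)) ⟶ (⟨X, C, a ≫ b⟩ : Comma π (𝟭 ℬ)) from
          ⟨𝟙 X, b, by simp⟩)) ∧
    (∀ (X : 𝒳) {B : ℬ} (a : π.obj X ⟶ B),
      (show (⟨X, B, a⟩ : Comma π (𝟭 ℬ)) ⟶ (⟨X, B, a⟩ : Comma π (𝟭 ℬ)) from
        ⟨𝟙 X, 𝟙 B, by simp⟩) = 𝟙 (⟨X, B, a⟩ : Comma π (𝟭 ℬ))) ∧
    (∀ (X : 𝒳) {B C D : ℬ} (a : π.obj X ⟶ B) (b : B ⟶ C) (c : C ⟶ D),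
      (show (⟨X, B, a⟩ : Comma π (𝟭 ℬ)) ⟶ (⟨X, C, a ≫ b⟩ : Comma π (𝟭 ℬ)) from
        ⟨𝟙 X, b, by simp⟩) ≫
      (show (⟨X, C, a ≫ b⟩ : Comma π (𝟭 ℬ)) ⟶ (⟨X, D, a ≫ b ≫ c⟩ : Comma π (𝟭 ℬ)) from
        ⟨𝟙 X, c, by simp⟩) =
      (show (⟨X, B, a⟩ : Comma π (𝟭 ℬ)) ⟶ (⟨X, D, a ≫ b ≫ c⟩ : Comma π (𝟭 ℬ)) from
        ⟨𝟙 X, b ≫ c, by simp⟩)) := by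
  refine ⟨fun X B C a b => ?_, fun X B a => rfl, fun X B C D a b c => ?_⟩
  · let f : (⟨X, B, a⟩ : Comma π (𝟭 ℬ)) ⟶ ⟨X, C, a ≫ b⟩ := ⟨𝟙 X, b, by simp⟩
    have hf : (Comma.snd π (𝟭 ℬ)).IsHomLift b f := IsHomLift.map (Comma.snd π (𝟭 ℬ)) f
    refine { toIsHomLift := hf, universal_property' := fun {Z} g z hz => ?_ }
    have hz' : b ≫ g = z.right := IsHomLift.eq_of_isHomLift (Comma.snd π (𝟭 ℬ)) (b ≫ g) z
    let y : (⟨X, C, a ≫ b⟩ : Comma π (𝟭 ℬ)) ⟶ Z :=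
      ⟨z.left, g, by simp [← hz']⟩
    refine ⟨y, ⟨IsHomLift.map (Comma.snd π (𝟭 ℬ)) y, ?_⟩, fun w ⟨hw, hwz⟩ => ?_⟩
    · ext
      · exact Category.id_comp z.left
      · exact hz'
    · ext
      · exact (Category.id_comp w.left).symm.trans (congrArg CommaMorphism.left hwz)
      · exact (IsHomLift.eq_of_isHomLift (Comma.snd π (𝟭 ℬ)) (a := ⟨X, C, a ≫ b⟩) g w).symm
  · ext
    · exact Category.comp_id (𝟙 X)
    · rfl
end

section
/- Let π : 𝒳 ⥤ ℬ be an opfibration equipped with a normalized cleavage, assigning to every X over A and every a : A ⟶ B a cocartesian arrow X ▷ a : X ⟶ a_*(X) lying over a with X ▷ 𝟙 A = 𝟙 X. Then there exists a functor ξ : Comma π (𝟭 ℬ) ⥤ 𝒳 with ξ ⋙ π = d₁ (the codomain functor), sending each object (X, a) to a_*(X), such that y_𝒳 ⋙ ξ is the identity functor of 𝒳 and there is an adjunction ξ ⊣ y_𝒳 whose counit is the identity and all of whose unit components are vertical with respect to d₁ (each lies over an identity arrow of ℬ). -/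
open CategoryTheory Functor

/-- The unit functor `y_𝒳 : 𝒳 ⥤ T(𝒳) = Comma π (𝟭 ℬ)`, sending `X` to `(X, 𝟙 (π X))`. -/
def yFun {𝒳 ℬ : Type*} [Category 𝒳] [Category ℬ] (π : 𝒳 ⥤ ℬ) : 𝒳 ⥤ Comma π (𝟭 ℬ) where
  obj X := ⟨X, π.obj X, 𝟙 (π.obj X)⟩
  map {X X'} x := ⟨x, π.map x, by simp⟩

section Cleavage

variable {𝒳 ℬ : Type*} [Category 𝒳] [Category ℬ] (π : 𝒳 ⥤ ℬ)
  {push : ∀ (X : 𝒳) {B : ℬ}, (π.obj X ⟶ B) → 𝒳}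
  (lift : ∀ (X : 𝒳) {B : ℬ} (a : π.obj X ⟶ B), X ⟶ push X a)
  [hcocart : ∀ (X : 𝒳) (B : ℬ) (a : π.obj X ⟶ B), π.IsStronglyCocartesian a (lift X a)]

/-- The arrow `a_*(X) ⟶ b_*(Y)` over `β` induced by a morphism `(x, β) : (X, a) ⟶ (Y, b)` of
the comma category. -/
noncomputable def cleavageMap {T T' : Comma π (𝟭 ℬ)} (f : T ⟶ T') :
    push T.left T.hom ⟶ push T'.left T'.hom :=
  IsStronglyCocartesian.map π T.hom (lift T.left T.hom) (g := f.right)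
    (f' := π.map f.left ≫ T'.hom) f.w (f.left ≫ lift T'.left T'.hom)

instance cleavageMap_isHomLift {T T' : Comma π (𝟭 ℬ)} (f : T ⟶ T') :
    π.IsHomLift f.right (cleavageMap π lift f) :=
  IsStronglyCocartesian.map_isHomLift ..

lemma lift_cleavageMap {T T' : Comma π (𝟭 ℬ)} (f : T ⟶ T') :
    lift T.left T.hom ≫ cleavageMap π lift f = f.left ≫ lift T'.left T'.hom :=
  IsStronglyCocartesian.fac ..

lemma lift_cleavageMap_assoc {T T' : Comma π (𝟭 ℬ)} (f : T ⟶ T') {Z : 𝒳}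
    (h : push T'.left T'.hom ⟶ Z) :
    lift T.left T.hom ≫ cleavageMap π lift f ≫ h = f.left ≫ lift T'.left T'.hom ≫ h := by
  rw [← Category.assoc, lift_cleavageMap, Category.assoc]

lemma obj_push_eq (lift : ∀ (X : 𝒳) {B : ℬ} (a : π.obj X ⟶ B), X ⟶ push X a)
    [∀ (X : 𝒳) (B : ℬ) (a : π.obj X ⟶ B), π.IsStronglyCocartesian a (lift X a)]
    {X : 𝒳} {B : ℬ} (a : π.obj X ⟶ B) : π.obj (push X a) = B :=
  IsHomLift.codomain_eq π a (lift X a)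

/-- The functor `T(𝒳) ⥤ 𝒳` sending `(X, a)` to `a_*(X)`. -/
noncomputable def cleavageFunctor : Comma π (𝟭 ℬ) ⥤ 𝒳 where
  obj T := push T.left T.hom
  map f := cleavageMap π lift f
  map_id T := by
    have : π.IsHomLift (𝟙 T : T ⟶ T).right (𝟙 (push T.left T.hom)) :=
      IsHomLift.id (obj_push_eq π lift T.hom)
    apply IsStronglyCocartesian.ext π T.hom (lift T.left T.hom) (𝟙 T : T ⟶ T).right
    exact (lift_cleavageMap π lift (𝟙 T)).trans (by simp)
  map_comp {T T' T''} f g := by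
    have : π.IsHomLift (f ≫ g).right (cleavageMap π lift f ≫ cleavageMap π lift g) :=
      IsHomLift.comp π f.right g.right _ _
    apply IsStronglyCocartesian.ext π T.hom (lift T.left T.hom) (f ≫ g).right
    calc
      _ = f.left ≫ g.left ≫ lift T''.left T''.hom := by
        rw [lift_cleavageMap, Comma.comp_left, Category.assoc]
      _ = f.left ≫ lift T'.left T'.hom ≫ cleavageMap π lift g := by rw [lift_cleavageMap]
      _ = _ := (lift_cleavageMap_assoc π lift f _).symm

lemma cleavageFunctor_comp : cleavageFunctor π lift ⋙ π = Comma.snd π (𝟭 ℬ) :=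
  CategoryTheory.Functor.ext (fun T => obj_push_eq π lift T.hom)
    (fun _ _ f => IsHomLift.fac' π f.right (cleavageMap π lift f))

/-- The unit component `(X, a) ⟶ (a_*(X), 𝟙)`, given by the chosen lift of `a`. -/
def cleavageUnitApp (T : Comma π (𝟭 ℬ)) : T ⟶ (yFun π).obj (push T.left T.hom) where
  left := lift T.left T.hom
  right := eqToHom (obj_push_eq π lift T.hom).symm
  w := by
    have h := IsHomLift.fac' π T.hom (lift T.left T.hom)
    rw [eqToHom_refl, Category.id_comp] at h
    exact (Category.comp_id _).trans h

lemma cleavageUnitApp_isHomLift (T : Comma π (𝟭 ℬ)) :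
    (Comma.snd π (𝟭 ℬ)).IsHomLift (𝟙 T.right) (cleavageUnitApp π lift T) :=
  IsHomLift.of_fac' _ _ _ rfl (obj_push_eq π lift T.hom) (by simp [cleavageUnitApp])

/-- The chosen lifts, as a natural transformation. -/
noncomputable def cleavageUnit : 𝟭 (Comma π (𝟭 ℬ)) ⟶ cleavageFunctor π lift ⋙ yFun π where
  app T := cleavageUnitApp π lift T
  naturality T T' f := by
    apply Comma.hom_ext
    · exact (lift_cleavageMap π lift f).symm
    · simp [cleavageUnitApp, yFun, cleavageFunctor,
        IsHomLift.fac' π f.right (cleavageMap π lift f)]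

lemma yFun_comp_cleavageFunctor
    (hpushid : ∀ X : 𝒳, push X (𝟙 (π.obj X)) = X)
    (hnorm : ∀ X : 𝒳, lift X (𝟙 (π.obj X)) = eqToHom (hpushid X).symm) :
    yFun π ⋙ cleavageFunctor π lift = 𝟭 𝒳 := by
  refine CategoryTheory.Functor.ext hpushid fun X X' f => ?_
  have h := lift_cleavageMap π lift ((yFun π).map f)
  simp only [yFun, hnorm] at h
  rw [eqToHom_comp_iff] at h
  exact h

/-- The adjunction between the functor of a normalized cleavage and `yFun π`. -/
noncomputable def cleavageAdjunction
    (hpushid : ∀ X : 𝒳, push X (𝟙 (π.obj X)) = X)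
    (hnorm : ∀ X : 𝒳, lift X (𝟙 (π.obj X)) = eqToHom (hpushid X).symm) :
    cleavageFunctor π lift ⊣ yFun π where
  unit := cleavageUnit π lift
  counit := eqToHom (yFun_comp_cleavageFunctor π lift hpushid hnorm)
  left_triangle_components T := by
    have hT := obj_push_eq π lift T.hom
    have : π.IsHomLift (cleavageUnitApp π lift T).right (𝟙 (push T.left T.hom)) :=
      IsHomLift.id_lift_eqToHom_domain hT.symm hT
    have : π.IsHomLift (cleavageUnitApp π lift T).right
        (cleavageMap π lift (cleavageUnitApp π lift T) ≫
          eqToHom (hpushid (push T.left T.hom))) :=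
      IsHomLift.eqToHom_comp_lift ..
    rw [eqToHom_app]
    change cleavageMap π lift (cleavageUnitApp π lift T) ≫
      eqToHom (hpushid (push T.left T.hom)) = 𝟙 (push T.left T.hom)
    apply IsStronglyCocartesian.ext π T.hom (lift T.left T.hom) (cleavageUnitApp π lift T).right
    refine (lift_cleavageMap_assoc π lift (cleavageUnitApp π lift T) _).trans ?_
    simp [cleavageUnitApp, yFun, hnorm]
  right_triangle_components X := by
    rw [eqToHom_app]
    apply Comma.hom_ext
    · change lift X (𝟙 (π.obj X)) ≫ eqToHom (hpushid X) = 𝟙 X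
      simp [hnorm]
    · change eqToHom (obj_push_eq π lift _).symm ≫ π.map (eqToHom (hpushid X)) = 𝟙 (π.obj X)
      simp [eqToHom_map]

end Cleavage

/-- A normalized cleavage on `π : 𝒳 ⥤ ℬ` gives rise to a functor `ξ : T(𝒳) ⥤ 𝒳` over `ℬ`,
sending `(X, a)` to `a_*(X)`, which is a vertical left adjoint left inverse of `y_𝒳`
(left adjoint with identity counit and vertical unit components). -/
theorem cleavage_gives_lali {𝒳 ℬ : Type*} [Category 𝒳] [Category ℬ] (π : 𝒳 ⥤ ℬ)
    (push : ∀ (X : 𝒳) {B : ℬ}, (π.obj X ⟶ B) → 𝒳)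
    (lift : ∀ (X : 𝒳) {B : ℬ} (a : π.obj X ⟶ B), X ⟶ push X a)
    (hpushid : ∀ X : 𝒳, push X (𝟙 (π.obj X)) = X)
    (hcocart : ∀ (X : 𝒳) {B : ℬ} (a : π.obj X ⟶ B), π.IsStronglyCocartesian a (lift X a))
    (hnorm : ∀ X : 𝒳, lift X (𝟙 (π.obj X)) = eqToHom (hpushid X).symm) :
    ∃ (ξ : Comma π (𝟭 ℬ) ⥤ 𝒳) (_ : ξ ⋙ π = Comma.snd π (𝟭 ℬ))
      (h2 : yFun π ⋙ ξ = 𝟭 𝒳),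
      (∀ T : Comma π (𝟭 ℬ), ξ.obj T = push T.left T.hom) ∧
      ∃ adj : ξ ⊣ yFun π,
        (∀ X : 𝒳, adj.counit.app X = eqToHom (Functor.congr_obj h2 X)) ∧
        (∀ T : Comma π (𝟭 ℬ),
          (Comma.snd π (𝟭 ℬ)).IsHomLift (𝟙 T.right) (adj.unit.app T)) := by
  have (X : 𝒳) (B : ℬ) (a : π.obj X ⟶ B) : π.IsStronglyCocartesian a (lift X a) := hcocart X a
  exact ⟨cleavageFunctor π lift, cleavageFunctor_comp π lift,
    yFun_comp_cleavageFunctor π lift hpushid hnorm, fun _ => rfl,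
    cleavageAdjunction π lift hpushid hnorm,
    eqToHom_app (yFun_comp_cleavageFunctor π lift hpushid hnorm),
    cleavageUnitApp_isHomLift π lift⟩
end

section
/- Let π : 𝒳 ⥤ ℬ be a functor and suppose given a functor ξ : Comma π (𝟭 ℬ) ⥤ 𝒳 with ξ ⋙ π = d₁ (the codomain functor) and y_𝒳 ⋙ ξ equal to the identity functor of 𝒳, together with an adjunction ξ ⊣ y_𝒳 whose counit is the identity and all of whose unit components are vertical with respect to d₁. Then for every object X of 𝒳 over A and every arrow a : A ⟶ B of ℬ, the arrow ξ.map (𝟙 X, a), the image under ξ of the morphism (𝟙 X, a) : (X, 𝟙 A) ⟶ (X, a) of Comma π (𝟭 ℬ), is a cocartesian arrow of 𝒳 lying over a with domain X; in particular, π is an opfibration. -/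
open CategoryTheory Functor

section

variable {𝒳 ℬ : Type*} [Category 𝒳] [Category ℬ] {π : 𝒳 ⥤ ℬ} {ξ : Comma π (𝟭 ℬ) ⥤ 𝒳}

/-- The left component `X ⟶ ξ.obj T` of the unit of `ξ ⊣ yFun π` at `T = (X, a)`. -/
def unitLeft (adj : ξ ⊣ yFun π) (T : Comma π (𝟭 ℬ)) : T.left ⟶ ξ.obj T :=
  (adj.unit.app T).left

theorem homEquiv_left (adj : ξ ⊣ yFun π) {T : Comma π (𝟭 ℬ)} {Z : 𝒳} (χ : ξ.obj T ⟶ Z) :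
    (adj.homEquiv T Z χ).left = unitLeft adj T ≫ χ := by
  rw [adj.homEquiv_unit]
  rfl

/-- If the unit of `ξ ⊣ yFun π` is vertical at `T = (X, a)`, then its left component
`X ⟶ ξ.obj T` is cocartesian over `a`. -/
theorem unitLeft_isStronglyCocartesian (adj : ξ ⊣ yFun π) (T : Comma π (𝟭 ℬ))
    (hT : (Comma.snd π (𝟭 ℬ)).IsHomLift (𝟙 T.right) (adj.unit.app T)) :
    π.IsStronglyCocartesian (R := π.obj T.left) (S := T.right) T.hom (unitLeft adj T) := by
  have hB : π.obj (ξ.obj T) = T.right :=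
    IsHomLift.codomain_eq (Comma.snd π (𝟭 ℬ)) (𝟙 T.right) (adj.unit.app T)
  have hr : (adj.unit.app T).right = eqToHom hB.symm := by
    have := IsHomLift.fac' (Comma.snd π (𝟭 ℬ)) (𝟙 T.right) (adj.unit.app T)
    rw [eqToHom_refl, Category.id_comp, Category.id_comp] at this
    exact this
  have hw : π.map (unitLeft adj T) = T.hom ≫ eqToHom hB.symm := by
    have h : π.map (unitLeft adj T) ≫ 𝟙 _ = T.hom ≫ (adj.unit.app T).right :=
      (adj.unit.app T).w
    rw [Category.comp_id, hr] at h
    exact h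
  have lift_iff {Z : 𝒳} (g : T.right ⟶ π.obj Z) (χ : ξ.obj T ⟶ Z) :
      π.IsHomLift g χ ↔ (adj.homEquiv T Z χ).right = g := by
    have hχ : (adj.homEquiv T Z χ).right = eqToHom hB.symm ≫ π.map χ := by
      rw [adj.homEquiv_unit, Comma.comp_right, hr]
      rfl
    rw [hχ]
    constructor
    · intro h
      have := (IsHomLift.fac π g χ).symm
      rw [eqToHom_refl, Category.comp_id] at this
      exact this
    · rintro rfl
      exact IsHomLift.lift_eqToHom_comp π (π.map χ) χ hB.symm
  have : π.IsHomLift (R := π.obj T.left) (S := T.right) T.hom (unitLeft adj T) :=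
    IsHomLift.of_fac' π _ _ rfl hB (by rw [hw, eqToHom_refl, Category.id_comp])
  refine ⟨fun {Z} g x hx => ?_⟩
  have hxg : π.map x = T.hom ≫ g := (IsHomLift.eq_of_isHomLift π _ x).symm
  let m : T ⟶ (yFun π).obj Z := ⟨x, g, (Category.comp_id _).trans hxg⟩
  refine ⟨(adj.homEquiv T Z).symm m, ⟨?_, ?_⟩, ?_⟩
  · rw [lift_iff, Equiv.apply_symm_apply]
  · rw [← homEquiv_left, Equiv.apply_symm_apply]
  · rintro χ ⟨hg, hχ⟩
    rw [Equiv.eq_symm_apply]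
    apply Comma.hom_ext
    · rw [homEquiv_left, hχ]
    · exact (lift_iff g χ).1 hg

/-- If the counit of `ξ ⊣ yFun π` is invertible at `X`, then the image under `ξ` of a morphism
`f : (X, 𝟙) ⟶ T` is determined by the left component of the unit at `T`. -/
theorem map_eq_counit_comp_unitLeft (adj : ξ ⊣ yFun π) {X : 𝒳}
    (e : ξ.obj ((yFun π).obj X) ≅ X) (he : e.hom = adj.counit.app X)
    {T : Comma π (𝟭 ℬ)} (f : (yFun π).obj X ⟶ T) (x : X ⟶ T.left) (hx : f.left = x) :
    ξ.map f = e.hom ≫ x ≫ unitLeft adj T := by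
  let u : X ⟶ ξ.obj ((yFun π).obj X) := unitLeft adj ((yFun π).obj X)
  have hn : x ≫ unitLeft adj T = u ≫ ξ.map f :=
    hx ▸ congrArg CommaMorphism.left (adj.unit.naturality f)
  have ht : u ≫ e.hom = 𝟙 X :=
    he ▸ congrArg CommaMorphism.left (adj.right_triangle_components X)
  rw [hn, (Iso.eq_comp_inv e).2 ht, Category.id_comp, e.hom_inv_id_assoc]

end

/-- A vertical left adjoint left inverse `ξ` of `y_𝒳` (left adjoint with identity counit and
vertical unit components) provides cocartesian lifts: `ξ.map (𝟙 X, a)` is cocartesian over `a`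
with domain `X`; in particular `π` is an opfibration. -/
theorem lali_gives_opfibration {𝒳 ℬ : Type*} [Category 𝒳] [Category ℬ] (π : 𝒳 ⥤ ℬ)
    (ξ : Comma π (𝟭 ℬ) ⥤ 𝒳)
    (h1 : ξ ⋙ π = Comma.snd π (𝟭 ℬ)) (h2 : yFun π ⋙ ξ = 𝟭 𝒳)
    (adj : ξ ⊣ yFun π)
    (hcounit : ∀ X : 𝒳, adj.counit.app X = eqToHom (Functor.congr_obj h2 X))
    (hunit : ∀ T : Comma π (𝟭 ℬ),
      (Comma.snd π (𝟭 ℬ)).IsHomLift (𝟙 T.right) (adj.unit.app T)) :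
    (∀ (X : 𝒳) {B : ℬ} (a : π.obj X ⟶ B),
      π.IsStronglyCocartesian a
        (ξ.map (show (yFun π).obj X ⟶ (⟨X, B, a⟩ : Comma π (𝟭 ℬ)) from
          ⟨𝟙 X, a, by simp [yFun]⟩))) ∧
    (∀ {A B : ℬ} (a : A ⟶ B) (X : 𝒳), π.obj X = A →
      ∃ (Y : 𝒳) (x : X ⟶ Y), π.IsStronglyCocartesian a x) := by
  refine ⟨fun X B a => ?_, ?_⟩
  · have hX : ξ.obj ((yFun π).obj X) = X := Functor.congr_obj h2 X
    have hc : π.IsStronglyCocartesian a (unitLeft adj ⟨X, B, a⟩) :=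
      unitLeft_isStronglyCocartesian adj ⟨X, B, a⟩ (hunit _)
    have he : π.IsHomLift (𝟙 (π.obj X)) (eqToIso hX).hom :=
      IsHomLift.eqToHom_codomain_lift_id hX rfl
    rw [map_eq_counit_comp_unitLeft adj (eqToIso hX) (hcounit X).symm _ (𝟙 X) rfl,
      Category.id_comp]
    have hcomp : π.IsStronglyCocartesian (𝟙 (π.obj X) ≫ a)
        ((eqToIso hX).hom ≫ unitLeft adj ⟨X, B, a⟩) :=
      IsStronglyCocartesian.comp π
    rwa [Category.id_comp] at hcomp
  · rintro A B a X rfl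
    exact ⟨_, _, unitLeft_isStronglyCocartesian adj ⟨X, B, a⟩ (hunit _)⟩
end

section
/- (Giraud) Every opfibration is equivalent over the base to a split opfibration: if π : 𝒳 ⥤ ℬ is an opfibration, then there exist a category 𝒳', an opfibration π' : 𝒳' ⥤ ℬ equipped with a splitting (a normalized cleavage whose chosen cocartesian lifts satisfy (X ▷ a) ≫ (a_*(X) ▷ b) = X ▷ (a ≫ b)), functors F : 𝒳 ⥤ 𝒳' and G : 𝒳' ⥤ 𝒳 with F ⋙ π' = π and G ⋙ π = π', and natural isomorphisms 𝟭 𝒳 ≅ F ⋙ G and G ⋙ F ≅ 𝟭 𝒳' all of whose components are vertical (each lies over an identity arrow of ℬ). -/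
open CategoryTheory Functor

universe v₁ v₂ u₁ u₂

/-- A cleavage for `π`: a choice of strongly cocartesian lifts. -/
structure Cleavage {𝒳 : Type u₂} {ℬ : Type u₁} [Category.{v₂} 𝒳] [Category.{v₁} ℬ]
    (π : 𝒳 ⥤ ℬ) where
  /-- The codomain of the chosen lift. -/
  obj (X : 𝒳) {B : ℬ} (a : π.obj X ⟶ B) : 𝒳
  /-- The chosen lift. -/
  arr (X : 𝒳) {B : ℬ} (a : π.obj X ⟶ B) : X ⟶ obj X a
  isStronglyCocartesian (X : 𝒳) {B : ℬ} (a : π.obj X ⟶ B) :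
    π.IsStronglyCocartesian a (arr X a)

namespace Cleavage

variable {𝒳 : Type u₂} {ℬ : Type u₁} [Category.{v₂} 𝒳] [Category.{v₁} ℬ]
  {π : 𝒳 ⥤ ℬ} (κ : Cleavage π)

/-- Objects of the split replacement of `π`: formal pushforwards of an object `src` along an
arrow `arrow` of the base. -/
structure SplitObj (κ : Cleavage π) : Type (max u₁ u₂ v₁ v₂) where
  /-- The object to be pushed forward. -/
  src : 𝒳
  /-- The base object over which the pushforward lies. -/
  base : ℬ
  /-- The arrow along which to push forward. -/
  arrow : π.obj src ⟶ base

namespace SplitObj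

variable {κ}

/-- The actual pushforward represented by a formal one. -/
def val (P : κ.SplitObj) : 𝒳 := κ.obj P.src P.arrow

/-- The chosen cocartesian arrow to the actual pushforward. -/
def ι (P : κ.SplitObj) : P.src ⟶ P.val := κ.arr P.src P.arrow

instance isStronglyCocartesian_ι (P : κ.SplitObj) : π.IsStronglyCocartesian P.arrow P.ι :=
  κ.isStronglyCocartesian P.src P.arrow

lemma obj_val (P : κ.SplitObj) : π.obj P.val = P.base :=
  IsHomLift.codomain_eq π P.arrow P.ι

/-- Morphisms of formal pushforwards are morphisms of the actual ones. -/
@[ext]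
structure Hom (P Q : κ.SplitObj) : Type (max v₁ v₂) where
  /-- The underlying morphism. -/
  hom : P.val ⟶ Q.val

instance : Category.{max v₁ v₂} κ.SplitObj where
  Hom := Hom
  id P := ⟨𝟙 P.val⟩
  comp f g := ⟨f.hom ≫ g.hom⟩

@[ext]
lemma hom_ext {P Q : κ.SplitObj} {f g : P ⟶ Q} (h : f.hom = g.hom) : f = g :=
  Hom.ext h

@[simp]
lemma id_hom (P : κ.SplitObj) : Hom.hom (𝟙 P) = 𝟙 P.val := rfl

@[simp]
lemma comp_hom {P Q R : κ.SplitObj} (f : P ⟶ Q) (g : Q ⟶ R) :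
    (f ≫ g).hom = f.hom ≫ g.hom := rfl

lemma eqToHom_hom {P Q : κ.SplitObj} (h : P = Q) :
    (eqToHom h).hom = eqToHom (congrArg val h) := by
  subst h; rfl

variable (κ) in
/-- The functor from the split replacement evaluating formal pushforwards. -/
@[simps]
def eval : κ.SplitObj ⥤ 𝒳 where
  obj := val
  map f := f.hom

variable (κ) in
/-- The projection of the split replacement to the base. -/
abbrev proj : κ.SplitObj ⥤ ℬ := eval κ ⋙ π

lemma isHomLift_proj_iff {P Q : κ.SplitObj} {A B : ℬ} (a : A ⟶ B) (f : P ⟶ Q) :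
    (proj κ).IsHomLift a f ↔ π.IsHomLift a f.hom := by
  constructor
  · rintro ⟨⟩
    exact .map f.hom
  · intro h
    have h_fac := IsHomLift.fac' π a f.hom
    exact IsHomLift.of_fac' (proj κ) a f (IsHomLift.domain_eq (a := P.val) π a f.hom)
      (IsHomLift.codomain_eq (b := Q.val) π a f.hom) h_fac

lemma isStronglyCocartesian_proj {P Q : κ.SplitObj} {A B : ℬ} (a : A ⟶ B) (f : P ⟶ Q)
    [π.IsStronglyCocartesian a f.hom] : (proj κ).IsStronglyCocartesian a f where
  toIsHomLift := (isHomLift_proj_iff a f).2 inferInstance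
  universal_property' {R} g z hz := by
    have := (isHomLift_proj_iff _ z).1 hz
    obtain ⟨χ, ⟨hχ, hfac⟩, huniq⟩ :=
      IsStronglyCocartesian.universal_property π a f.hom g _ rfl z.hom
    refine ⟨⟨χ⟩, ⟨(isHomLift_proj_iff g _).2 hχ, hom_ext hfac⟩, fun y ⟨hy, hy'⟩ ↦ ?_⟩
    exact hom_ext (huniq y.hom ⟨(isHomLift_proj_iff g y).1 hy, congrArg Hom.hom hy'⟩)

/-- The formal pushforward of a formal pushforward. -/
abbrev push (P : κ.SplitObj) {B : ℬ} (a : π.obj P.val ⟶ B) : κ.SplitObj where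
  src := P.src
  base := B
  arrow := P.arrow ≫ eqToHom P.obj_val.symm ≫ a

instance (P : κ.SplitObj) {B : ℬ} (a : π.obj P.val ⟶ B) :
    π.IsStronglyCocartesian (P.arrow ≫ eqToHom P.obj_val.symm ≫ a) (P.push a).ι :=
  isStronglyCocartesian_ι (P.push a)

/-- The canonical arrow from a formal pushforward to its pushforward. -/
noncomputable def lift (P : κ.SplitObj) {B : ℬ} (a : π.obj P.val ⟶ B) : P ⟶ P.push a :=
  ⟨IsStronglyCocartesian.map π P.arrow P.ι (g := eqToHom P.obj_val.symm ≫ a)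
    rfl (P.push a).ι⟩

lemma ι_lift (P : κ.SplitObj) {B : ℬ} (a : π.obj P.val ⟶ B) :
    P.ι ≫ (P.lift a).hom = (P.push a).ι :=
  IsStronglyCocartesian.fac π P.arrow P.ι (f' := P.arrow ≫ eqToHom P.obj_val.symm ≫ a) rfl _

lemma ι_lift_assoc (P : κ.SplitObj) {B : ℬ} (a : π.obj P.val ⟶ B) {Z : 𝒳}
    (z : (P.push a).val ⟶ Z) : P.ι ≫ (P.lift a).hom ≫ z = (P.push a).ι ≫ z := by
  rw [← Category.assoc, ι_lift]

instance (P : κ.SplitObj) {B : ℬ} (a : π.obj P.val ⟶ B) : π.IsHomLift a (P.lift a).hom := by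
  rw [← IsHomLift.lift_eqToHom_comp_iff π a _ P.obj_val.symm]
  exact IsStronglyCocartesian.map_isHomLift π P.arrow P.ι
    (f' := P.arrow ≫ eqToHom P.obj_val.symm ≫ a) rfl _

instance (P : κ.SplitObj) {B : ℬ} (a : π.obj P.val ⟶ B) :
    π.IsStronglyCocartesian a (P.lift a).hom where
  universal_property' {Z} g z hz := by
    have : π.IsHomLift ((P.push a).arrow ≫ g) (P.ι ≫ z) := by
      have : π.IsHomLift (P.arrow ≫ (eqToHom P.obj_val.symm ≫ a ≫ g)) (P.ι ≫ z) :=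
        inferInstance
      simpa using this
    obtain ⟨χ, ⟨hχ, hfac⟩, huniq⟩ :=
      IsStronglyCocartesian.universal_property π (P.push a).arrow (P.push a).ι g _ rfl (P.ι ≫ z)
    refine ⟨χ, ⟨hχ, ?_⟩, fun y ⟨hy, hy'⟩ ↦ huniq y ⟨hy, ?_⟩⟩
    · refine IsStronglyCocartesian.ext π P.arrow P.ι (eqToHom P.obj_val.symm ≫ a ≫ g) ?_
      rw [ι_lift_assoc, hfac]
    · rw [← ι_lift_assoc, hy']

lemma isStronglyCocartesian_lift (P : κ.SplitObj) {B : ℬ} (a : π.obj P.val ⟶ B) :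
    (proj κ).IsStronglyCocartesian a (P.lift a) :=
  isStronglyCocartesian_proj a (P.lift a)

lemma mk_comp_eqToHom {X : 𝒳} {B C : ℬ} (a : π.obj X ⟶ B) (h : B = C) :
    (⟨X, C, a ≫ eqToHom h⟩ : κ.SplitObj) = ⟨X, B, a⟩ := by
  subst h
  simp

lemma ι_comp_eqToHom {P Q : κ.SplitObj} (h : P = Q) :
    P.ι ≫ (eqToHom h).hom = eqToHom (congrArg src h) ≫ Q.ι := by
  subst h
  simp

lemma push_id (P : κ.SplitObj) : P.push (𝟙 (π.obj P.val)) = P := by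
  rw [push, Category.comp_id]
  exact mk_comp_eqToHom P.arrow P.obj_val.symm

lemma lift_id (P : κ.SplitObj) : P.lift (𝟙 (π.obj P.val)) = eqToHom P.push_id.symm := by
  ext
  have : π.IsHomLift (𝟙 (π.obj P.val)) (eqToHom P.push_id.symm).hom := by
    rw [eqToHom_hom]
    exact IsHomLift.eqToHom_domain_lift_id _ rfl
  refine IsStronglyCocartesian.ext π P.arrow P.ι (eqToHom P.obj_val.symm ≫ 𝟙 _) ?_
  rw [ι_lift, ι_comp_eqToHom]
  exact (Category.id_comp _).symm

lemma push_push (P : κ.SplitObj) {B C : ℬ} (a : π.obj P.val ⟶ B) (b : B ⟶ C) :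
    (P.push a).push (eqToHom (P.push a).obj_val ≫ b) = P.push (a ≫ b) := by
  simp [push]

lemma lift_lift (P : κ.SplitObj) {B C : ℬ} (a : π.obj P.val ⟶ B) (b : B ⟶ C) :
    P.lift a ≫ (P.push a).lift (eqToHom (P.push a).obj_val ≫ b) ≫ eqToHom (P.push_push a b) =
      P.lift (a ≫ b) := by
  ext
  have : π.IsHomLift b ((P.push a).lift (eqToHom (P.push a).obj_val ≫ b)).hom := by
    rw [← IsHomLift.lift_eqToHom_comp_iff π b _ (P.push a).obj_val]
    infer_instance
  simp only [comp_hom, eqToHom_hom]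
  refine IsStronglyCocartesian.ext π P.arrow P.ι (eqToHom P.obj_val.symm ≫ a ≫ b) ?_
  rw [ι_lift, ι_lift_assoc, ι_lift_assoc, ← eqToHom_hom (P.push_push a b)]
  exact (ι_comp_eqToHom _).trans (Category.id_comp _)

variable (κ) in
/-- The formal pushforward of an object along an identity. -/
abbrev ofObj (X : 𝒳) : κ.SplitObj := ⟨X, π.obj X, 𝟙 _⟩

variable (κ) in
/-- The arrow `X ⟶ (ofObj κ X).val`, which is a vertical isomorphism. -/
def unit (X : 𝒳) : X ⟶ (ofObj κ X).val := (ofObj κ X).ι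

instance (X : 𝒳) : π.IsStronglyCocartesian (𝟙 (π.obj X)) (unit κ X) :=
  isStronglyCocartesian_ι (ofObj κ X)

instance (X : 𝒳) : IsIso (unit κ X) :=
  IsStronglyCocartesian.isIso_of_base_isIso π (𝟙 (π.obj X)) (unit κ X)

variable (κ) in
/-- The functor to the split replacement sending an object to its formal pushforward along the
identity. -/
@[simps]
noncomputable def embed : 𝒳 ⥤ κ.SplitObj where
  obj := ofObj κ
  map {X Y} f := ⟨CategoryTheory.inv (unit κ X) ≫ f ≫ unit κ Y⟩

lemma embed_proj : embed κ ⋙ proj κ = π :=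
  CategoryTheory.Functor.ext (fun X : 𝒳 ↦ (ofObj κ X).obj_val) fun X Y f ↦
    IsHomLift.fac' π (π.map f) (CategoryTheory.inv (unit κ X) ≫ f ≫ unit κ Y)

variable (κ) in
/-- An object is vertically isomorphic to its pushforward along the identity. -/
noncomputable def unitIso : 𝟭 𝒳 ≅ embed κ ⋙ eval κ :=
  NatIso.ofComponents (fun X ↦ (asIso (unit κ X) :)) fun {X Y} f ↦
    (IsIso.hom_inv_id_assoc (unit κ X) (f ≫ unit κ Y)).symm

variable (κ) in
/-- A formal pushforward is vertically isomorphic to the one represented by its value. -/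
noncomputable def counitIso : eval κ ⋙ embed κ ≅ 𝟭 κ.SplitObj :=
  NatIso.ofComponents (fun P ↦
    { hom := ⟨(CategoryTheory.inv (unit κ P.val) :)⟩
      inv := ⟨unit κ P.val⟩
      hom_inv_id := hom_ext (IsIso.inv_hom_id (unit κ P.val))
      inv_hom_id := hom_ext (IsIso.hom_inv_id (unit κ P.val)) }) fun {P Q} f ↦ hom_ext <|
    show (CategoryTheory.inv (unit κ P.val) ≫ f.hom ≫ unit κ Q.val) ≫
      CategoryTheory.inv (unit κ Q.val) = CategoryTheory.inv (unit κ P.val) ≫ f.hom by simp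

lemma isHomLift_unitIso (X : 𝒳) : π.IsHomLift (𝟙 (π.obj X)) ((unitIso κ).hom.app X) :=
  inferInstanceAs (π.IsHomLift (𝟙 (π.obj X)) (unit κ X))

lemma isHomLift_counitIso (P : κ.SplitObj) :
    (proj κ).IsHomLift (𝟙 (π.obj P.val)) ((counitIso κ).hom.app P) :=
  (isHomLift_proj_iff _ _).2
    (inferInstanceAs (π.IsHomLift (𝟙 (π.obj P.val)) (CategoryTheory.inv (unit κ P.val))))

end SplitObj

end Cleavage

/-- (Giraud) Every opfibration is equivalent, over the base and via vertical natural
isomorphisms, to an opfibration equipped with a splitting. -/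
theorem opfibration_equivalent_to_split {𝒳 : Type u₂} {ℬ : Type u₁}
    [Category.{v₂} 𝒳] [Category.{v₁} ℬ] (π : 𝒳 ⥤ ℬ)
    (hopf : ∀ {A B : ℬ} (a : A ⟶ B) (X : 𝒳), π.obj X = A →
      ∃ (Y : 𝒳) (x : X ⟶ Y), π.IsStronglyCocartesian a x) :
    ∃ (𝒳' : Type (max u₁ u₂ v₁ v₂)) (_ : Category.{max v₁ v₂} 𝒳') (π' : 𝒳' ⥤ ℬ)
      -- a cleavage for `π'` :
      (push : ∀ (X' : 𝒳') {B : ℬ}, (π'.obj X' ⟶ B) → 𝒳')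
      (hpush : ∀ (X' : 𝒳') {B : ℬ} (a : π'.obj X' ⟶ B), π'.obj (push X' a) = B)
      (lift : ∀ (X' : 𝒳') {B : ℬ} (a : π'.obj X' ⟶ B), X' ⟶ push X' a)
      (_ : ∀ (X' : 𝒳') {B : ℬ} (a : π'.obj X' ⟶ B), π'.IsStronglyCocartesian a (lift X' a))
      -- which is normalized :
      (hpushid : ∀ X' : 𝒳', push X' (𝟙 (π'.obj X')) = X')
      (_ : ∀ X' : 𝒳', lift X' (𝟙 (π'.obj X')) = eqToHom (hpushid X').symm)
      -- and a splitting :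
      (hpushcomp : ∀ (X' : 𝒳') {B C : ℬ} (a : π'.obj X' ⟶ B) (b : B ⟶ C),
        push (push X' a) (eqToHom (hpush X' a) ≫ b) = push X' (a ≫ b))
      (_ : ∀ (X' : 𝒳') {B C : ℬ} (a : π'.obj X' ⟶ B) (b : B ⟶ C),
        lift X' a ≫ lift (push X' a) (eqToHom (hpush X' a) ≫ b) ≫
          eqToHom (hpushcomp X' a b) = lift X' (a ≫ b))
      -- and a vertical equivalence over `ℬ` between `𝒳` and `𝒳'` :
      (F : 𝒳 ⥤ 𝒳') (G : 𝒳' ⥤ 𝒳) (_ : F ⋙ π' = π) (_ : G ⋙ π = π')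
      (η : 𝟭 𝒳 ≅ F ⋙ G) (ε : G ⋙ F ≅ 𝟭 𝒳'),
      (∀ X : 𝒳, π.IsHomLift (𝟙 (π.obj X)) (η.hom.app X)) ∧
      (∀ X' : 𝒳', π'.IsHomLift (𝟙 (π'.obj X')) (ε.hom.app X')) := by
  choose obj arr hcocart using fun (X : 𝒳) (B : ℬ) (a : π.obj X ⟶ B) ↦ hopf a X rfl
  let κ : Cleavage π := ⟨fun X B a ↦ obj X B a, fun X B a ↦ arr X B a, fun X B a ↦ hcocart X B a⟩
  refine ⟨κ.SplitObj, inferInstance, Cleavage.SplitObj.proj κ, fun P _ a ↦ P.push a,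
    fun P _ a ↦ (P.push a).obj_val, fun P _ a ↦ P.lift a,
    fun P _ a ↦ P.isStronglyCocartesian_lift a,
    fun P ↦ P.push_id, fun P ↦ P.lift_id, fun P _ _ a b ↦ P.push_push a b,
    fun P _ _ a b ↦ P.lift_lift a b, Cleavage.SplitObj.embed κ, Cleavage.SplitObj.eval κ,
    Cleavage.SplitObj.embed_proj, rfl, Cleavage.SplitObj.unitIso κ,
    Cleavage.SplitObj.counitIso κ, Cleavage.SplitObj.isHomLift_unitIso,
    Cleavage.SplitObj.isHomLift_counitIso⟩
end

section
/- (Chevalley criterion) Let π : 𝒳 ⥤ ℬ be a functor and let π̄ : Arrow 𝒳 ⥤ Comma π (𝟭 ℬ) be the canonical functor sending an object x : X ⟶ Y of the arrow category to the object (X, π x : π X ⟶ π Y), and a morphism (u, v) of Arrow 𝒳 to the morphism (u, π v). Then π is an opfibration if and only if π̄ admits a left adjoint right inverse, i.e. there exists a functor K : Comma π (𝟭 ℬ) ⥤ Arrow 𝒳 with K ⋙ π̄ equal to the identity functor of Comma π (𝟭 ℬ) and an adjunction K ⊣ π̄ whose unit is the identity. -/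
open CategoryTheory Functor

/-- The canonical functor `π̄ : Arrow 𝒳 ⥤ Comma π (𝟭 ℬ)`, sending an arrow `x : X ⟶ Y` of `𝒳`
to the object `(X, π x : π X ⟶ π Y)`, and a morphism `(u, v)` to `(u, π v)`. -/
def piBar {𝒳 ℬ : Type*} [Category 𝒳] [Category ℬ] (π : 𝒳 ⥤ ℬ) :
    Arrow 𝒳 ⥤ Comma π (𝟭 ℬ) where
  obj x := ⟨x.left, π.obj x.right, π.map x.hom⟩
  map {x y} m := ⟨m.left, π.map m.right, by
    have := congrArg π.map m.w
    simp only [Functor.id_map, Functor.map_comp] at this ⊢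
    exact this⟩

/-- An arrow `k` is strongly cocartesian over its image if and only if morphisms out of it in the
arrow category are the same as morphisms out of its image under `piBar π`. -/
theorem isStronglyCocartesian_map_iff_bijective {𝒳 ℬ : Type*} [Category 𝒳] [Category ℬ]
    (π : 𝒳 ⥤ ℬ) (k : Arrow 𝒳) :
    π.IsStronglyCocartesian (π.map k.hom) k.hom ↔
      ∀ y : Arrow 𝒳, Function.Bijective ((piBar π).map : (k ⟶ y) → _) := by
  constructor
  · intro hk y
    have isHomLift_of_map_eq : ∀ {b c : 𝒳} (χ : b ⟶ c) (g : π.obj b ⟶ π.obj c),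
        π.map χ = g → π.IsHomLift g χ := by
      rintro b c χ _ rfl
      infer_instance
    constructor
    · intro f f' hff'
      have hl : f.left = f'.left := congrArg (fun m => m.left) hff'
      have hr : π.map f.right = π.map f'.right := congrArg (fun m => m.right) hff'
      have := isHomLift_of_map_eq f'.right (π.map f.right) hr.symm
      ext
      · exact hl
      · exact IsStronglyCocartesian.ext π (π.map k.hom) k.hom (π.map f.right)
          (by rw [← Arrow.w f, ← Arrow.w f', hl])
    · intro m
      let u : k.left ⟶ y.left := m.left
      let g : π.obj k.right ⟶ π.obj y.right := m.right
      have hm : π.map u ≫ π.map y.hom = π.map k.hom ≫ g := m.w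
      have := isHomLift_of_map_eq (u ≫ y.hom) (π.map k.hom ≫ g) (by rw [π.map_comp, hm])
      obtain ⟨χ, ⟨hχ, fac⟩, -⟩ := hk.universal_property' g (u ≫ y.hom)
      refine ⟨Arrow.homMk u χ fac.symm, ?_⟩
      apply CommaMorphism.ext
      · rfl
      · exact (IsHomLift.eq_of_isHomLift π g χ).symm
  · intro hk
    refine ⟨fun {c} g φ' hφ' => ?_⟩
    have hg : π.map k.hom ≫ g = π.map φ' := IsHomLift.eq_of_isHomLift π _ φ'
    let m : (piBar π).obj k ⟶ (piBar π).obj (Arrow.mk φ') :=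
      { left := 𝟙 k.left
        right := g
        w := by
          change π.map (𝟙 _) ≫ π.map φ' = π.map k.hom ≫ g
          rw [hg, π.map_id, Category.id_comp] }
    obtain ⟨f, hf⟩ := (hk (Arrow.mk φ')).2 m
    have hl : f.left = 𝟙 k.left := congrArg CommaMorphism.left hf
    have hr : π.map f.right = g := congrArg CommaMorphism.right hf
    refine ⟨f.right, ⟨hr ▸ inferInstance, ?_⟩, ?_⟩
    · have := Arrow.w f
      rw [hl] at this
      simpa using this.symm
    · rintro χ ⟨hχ, fac⟩
      have hfac : 𝟙 k.left ≫ φ' = k.hom ≫ χ := by rw [fac, Category.id_comp]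
      have : (Arrow.homMk (𝟙 k.left) χ hfac : k ⟶ Arrow.mk φ') = f := by
        apply (hk _).1
        rw [hf]
        apply CommaMorphism.ext
        · rfl
        · exact (IsHomLift.eq_of_isHomLift π g χ).symm
      exact congrArg CommaMorphism.right this

/-- A functor `G` has a left adjoint right inverse as soon as every object `X` has a strict
preimage `F X` from which `G` is bijective on morphisms. -/
theorem exists_leftAdjoint_rightInverse {C D : Type*} [Category C] [Category D] (G : D ⥤ C)
    (F : C → D) (hF : ∀ X, G.obj (F X) = X)
    (hG : ∀ X Y, Function.Bijective (G.map : (F X ⟶ Y) → _)) :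
    ∃ (K : C ⥤ D) (h : K ⋙ G = 𝟭 C) (adj : K ⊣ G),
      ∀ X : C, adj.unit.app X = eqToHom (Functor.congr_obj h X).symm := by
  let e (X : C) (Y : D) : (F X ⟶ Y) ≃ (X ⟶ G.obj Y) :=
    (Equiv.ofBijective _ (hG X Y)).trans (eqToIso (hF X)).homFromEquiv
  have e_apply (X : C) (Y : D) (f : F X ⟶ Y) : e X Y f = eqToHom (hF X).symm ≫ G.map f := rfl
  have he : ∀ X Y Y' g h, e X Y' (h ≫ g) = e X Y h ≫ G.map g := by
    intro X Y Y' g h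
    simp [e_apply]
  refine ⟨Adjunction.leftAdjointOfEquiv e he, CategoryTheory.Functor.ext hF fun X X' f => ?_,
    Adjunction.adjunctionOfEquivLeft e he, fun X => ?_⟩
  · have := (e X (F X')).apply_symm_apply (f ≫ e X' (F X') (𝟙 _))
    rw [e_apply X, eqToHom_comp_iff] at this
    refine this.trans ?_
    rw [e_apply, G.map_id, Category.comp_id]
    rfl
  · change e X (F X) (𝟙 _) = _
    rw [e_apply, G.map_id, Category.comp_id]

/-- If the unit of an adjunction is an isomorphism at `X`, then the right adjoint is bijective on
morphisms out of the image of `X`. -/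
theorem bijective_map_of_isIso_unit_app {C D : Type*} [Category C] [Category D]
    {K : C ⥤ D} {G : D ⥤ C} (adj : K ⊣ G) (X : C) [IsIso (adj.unit.app X)] (Y : D) :
    Function.Bijective (G.map : (K.obj X ⟶ Y) → _) := by
  have h : (G.map : (K.obj X ⟶ Y) → _) =
      (asIso (adj.unit.app X)).homFromEquiv ∘ adj.homEquiv X Y := by
    ext f
    simp [Adjunction.homEquiv_unit]
  rw [h]
  exact (Equiv.bijective _).comp (Equiv.bijective _)

/-- (Chevalley criterion) `π : 𝒳 ⥤ ℬ` is an opfibration iff the canonical functor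
`π̄ : Arrow 𝒳 ⥤ Comma π (𝟭 ℬ)` admits a left adjoint right inverse, i.e. a left adjoint `K`
with `K ⋙ π̄ = 𝟭` and identity unit. -/
theorem chevalley_criterion {𝒳 ℬ : Type*} [Category 𝒳] [Category ℬ] (π : 𝒳 ⥤ ℬ) :
    (∀ {A B : ℬ} (a : A ⟶ B) (X : 𝒳), π.obj X = A →
      ∃ (Y : 𝒳) (x : X ⟶ Y), π.IsStronglyCocartesian a x) ↔
    ∃ (K : Comma π (𝟭 ℬ) ⥤ Arrow 𝒳) (h : K ⋙ piBar π = 𝟭 (Comma π (𝟭 ℬ)))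
      (adj : K ⊣ piBar π),
      ∀ T : Comma π (𝟭 ℬ), adj.unit.app T = eqToHom (Functor.congr_obj h T).symm := by
  constructor
  · intro H
    have key : ∀ T : Comma π (𝟭 ℬ), ∃ k : Arrow 𝒳, (piBar π).obj k = T ∧
        π.IsStronglyCocartesian (π.map k.hom) k.hom := by
      rintro ⟨X, B, a⟩
      obtain ⟨Y, x, hx⟩ := H a X rfl
      obtain rfl : π.obj Y = B := IsHomLift.codomain_eq π a x
      obtain rfl : a = π.map x := IsHomLift.eq_of_isHomLift π a x
      exact ⟨Arrow.mk x, rfl, hx⟩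
    choose F hF hcocart using key
    exact exists_leftAdjoint_rightInverse (piBar π) F hF fun T =>
      (isStronglyCocartesian_map_iff_bijective π (F T)).1 (hcocart T)
  · rintro ⟨K, h, adj, hunit⟩ A B a X rfl
    have : IsIso (adj.unit.app ⟨X, B, a⟩) := by
      rw [hunit]
      infer_instance
    have hcocart := (isStronglyCocartesian_map_iff_bijective π _).2
      (bijective_map_of_isIso_unit_app adj ⟨X, B, a⟩)
    have hobj : (piBar π).obj (K.obj ⟨X, B, a⟩) = ⟨X, B, a⟩ := Functor.congr_obj h _
    generalize K.obj ⟨X, B, a⟩ = k at hcocart hobj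
    cases hobj
    exact ⟨_, _, hcocart⟩
end
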